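/- Let F(z), F̲(z), F̄(z), G(z), H(z) be the generating functions (by semilength) of Dyck paths that are (odd, odd)-avoiding, (weird, weird)-avoiding, (strange, strange)-avoiding, (odd, strange)-avoiding, and (strange, odd)-avoiding, respectively. Then these satisfy the system: F̲(z) − 1 = z·F(z)·F̲(z); F(z) − 1 = z·(F̄(z) − 1)·F(z); F̄(z) − 1 = z·F(z) + z·G(z)·(G(z) − 1); G(z) − 1 = z·H(z) + z·(F̄(z) − 1)·(G(z) − 1); and G(z) = H(z). -/

import Mathlib

/-- The height of a path after the steps in `l` (`true` = up step, `false` = down step). -/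
def ht (l : List Bool) : ℤ := 2 * (l.count true : ℤ) - l.length

/-- `p` is a Dyck path: equally many up and down steps, and every prefix has at least as
many up steps as down steps. -/
def IsDyck (p : List Bool) : Prop :=
  p.count true = p.count false ∧ ∀ i, (p.take i).count false ≤ (p.take i).count true

/-- An adjective describing a run of a Dyck path: a predicate taking the run length, the
proposition that the run touches the x-axis, and the proposition that the run contains the
first or last step of the path. -/
def RunAdj := ℕ → Prop → Prop → Prop

/-- A run is odd if its length is odd. -/
def oddAdj : RunAdj := fun len _ _ => Odd len

/-- A run is weird if it is odd and does not touch the x-axis, or even and touches it. -/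
def weirdAdj : RunAdj := fun len touch _ => (Odd len ∧ ¬ touch) ∨ (Even len ∧ touch)

/-- A run is strange if it is odd and contains neither the first nor the last step, or
even and contains the first or last step. -/
def strangeAdj : RunAdj := fun len _ extreme => (Odd len ∧ ¬ extreme) ∨ (Even len ∧ extreme)

/-- `p` contains an `α` ascending run immediately followed by a `β` descending run:
`p = l₁ ++ Uᵃ ++ Dᵇ ++ l₂` where `Uᵃ` and `Dᵇ` are maximal runs (`a, b ≥ 1`). An ascending
run touches the x-axis iff it starts at height `0`, a descending run iff it ends at height
`0`; the ascending run contains the first or last step iff `l₁ = []`, the descending run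
iff `l₂ = []`. -/
def ContainsRunPair (α β : RunAdj) (p : List Bool) : Prop :=
  ∃ (l₁ : List Bool) (a b : ℕ) (l₂ : List Bool),
    p = l₁ ++ List.replicate a true ++ List.replicate b false ++ l₂ ∧
    1 ≤ a ∧ 1 ≤ b ∧ l₁.getLast? ≠ some true ∧ l₂.head? ≠ some false ∧
    α a (ht l₁ = 0) (l₁ = []) ∧ β b (ht l₁ + a = b) (l₂ = [])

/-- The generating function, by semilength, for Dyck paths avoiding an `α` ascending run
immediately followed by a `β` descending run. -/
noncomputable def gfAvoid (α β : RunAdj) : PowerSeries ℚ :=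
  PowerSeries.mk fun n =>
    (Nat.card {p : List Bool // IsDyck p ∧ p.length = 2 * n ∧ ¬ ContainsRunPair α β p} : ℚ)

namespace DyckAvoid

open BinaryTree

/-- The Dyck path of a binary tree: the root contributes the first up step and its matching down
step, which separates the primary part from the secondary part. -/
def path : BinaryTree Unit → List Bool
  | nil => []
  | node _ q r => true :: (path q ++ false :: path r)

/-- The length of the final block of up steps. -/
def up : List Bool → ℕ
  | [] => 0
  | s :: x => if s = true ∧ ∀ t ∈ x, t = true then up x + 1 else up x

/-- The length of the initial block of down steps. -/
def dn : List Bool → ℕ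
  | [] => 0
  | true :: _ => 0
  | false :: y => dn y + 1

/-- `p` splits at a peak (an up step followed by a down step) into parts related by `R`. -/
def Peak (R : List Bool → List Bool → Prop) (p : List Bool) : Prop :=
  ∃ x y, p = x ++ y ∧ x.getLast? = some true ∧ y.head? = some false ∧ R x y

/-- The ascending run ending `x` and the descending run starting `y` satisfy `α` and `β`. -/
def RunRel (α β : RunAdj) (x y : List Bool) : Prop :=
  α (up x) (ht x = up x) (∀ s ∈ x, s = true) ∧ β (dn y) (ht x = dn y) (∀ s ∈ y, s = false)

@[simp] theorem ht_nil : ht [] = 0 := by simp [ht]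

@[simp] theorem ht_cons_true (x : List Bool) : ht (true :: x) = 1 + ht x := by
  simp [ht]; ring

@[simp] theorem ht_cons_false (x : List Bool) : ht (false :: x) = -1 + ht x := by
  simp [ht]; ring

@[simp] theorem ht_append (x y : List Bool) : ht (x ++ y) = ht x + ht y := by
  simp [ht]; ring

@[simp] theorem ht_replicate_true (a : ℕ) : ht (List.replicate a true) = a := by
  simp [ht]; ring

@[simp] theorem ht_replicate_false (a : ℕ) : ht (List.replicate a false) = -a := by
  simp [ht, List.count_replicate]

theorem ht_eq_sub (x : List Bool) : ht x = x.count true - x.count false := by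
  induction x with
  | nil => simp
  | cons s x ih => cases s <;> simp [ih] <;> ring

theorem exists_append_replicate_up (x : List Bool) :
    ∃ l, x = l ++ List.replicate (up x) true ∧ l.getLast? ≠ some true := by
  induction x with
  | nil => exact ⟨[], by simp [up]⟩
  | cons s x ih =>
    obtain ⟨l, hl, hl'⟩ := ih
    by_cases h : s = true ∧ ∀ t ∈ x, t = true
    · refine ⟨[], ?_, by simp⟩
      obtain ⟨rfl, h⟩ := h
      have : l = [] := by
        rcases List.eq_nil_or_concat l with rfl | ⟨l, t, rfl⟩
        · rfl
        · exact absurd (h t (by rw [hl]; simp)) (by simpa using hl')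
      subst this
      rw [up, if_pos ⟨rfl, h⟩, List.replicate_succ]
      simpa using hl
    · refine ⟨s :: l, by simp only [up, if_neg h]; simpa using hl, ?_⟩
      rcases List.eq_nil_or_concat l with rfl | ⟨l, t, rfl⟩
      · intro hs
        simp only [List.getLast?_singleton, Option.some.injEq] at hs
        refine h ⟨hs, fun t ht => ?_⟩
        rw [hl] at ht
        exact List.eq_of_mem_replicate (by simpa using ht)
      · simpa [List.getLast?_cons] using hl'

theorem exists_replicate_dn_append (y : List Bool) :
    ∃ l, y = List.replicate (dn y) false ++ l ∧ l.head? ≠ some false := by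
  induction y with
  | nil => exact ⟨[], by simp [dn]⟩
  | cons s y ih =>
    cases s
    · obtain ⟨l, hl, hl'⟩ := ih
      exact ⟨l, by simpa [dn, List.replicate_succ] using hl, hl'⟩
    · exact ⟨true :: y, by simp [dn]⟩

@[simp] theorem up_replicate (a : ℕ) : up (List.replicate a true) = a := by
  induction a with
  | zero => simp [up]
  | succ a ih => simp [List.replicate_succ, up, ih]

theorem up_append_false (q x : List Bool) : up (q ++ false :: x) = up x := by
  induction q with
  | nil => simp [up]
  | cons s q ih => simp [up, ih]

theorem up_append_replicate {l : List Bool} (a : ℕ) (h : l.getLast? ≠ some true) :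
    up (l ++ List.replicate a true) = a := by
  rcases List.eq_nil_or_concat l with rfl | ⟨l, t, rfl⟩
  · simp
  · cases t
    · simp [up_append_false]
    · simp at h

theorem dn_replicate_append {l : List Bool} (b : ℕ) (h : l.head? ≠ some false) :
    dn (List.replicate b false ++ l) = b := by
  induction b with
  | zero => rcases l with _ | ⟨_ | _, l⟩ <;> simp_all [dn]
  | succ b ih => simp [List.replicate_succ, dn, ih]

theorem ht_eq_up {x : List Bool} (h : ∀ s ∈ x, s = true) : ht x = up x := by
  rw [List.eq_replicate_of_mem h, up_replicate, ht_replicate_true]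

theorem ht_eq_neg_dn {y : List Bool} (h : ∀ s ∈ y, s = false) : ht y = -dn y := by
  have := dn_replicate_append (l := []) y.length (by simp)
  rw [List.append_nil] at this
  rw [List.eq_replicate_of_mem h, this, ht_replicate_false]

theorem dn_append_false {c r : List Bool} (h : r.head? ≠ some false) :
    dn (c ++ false :: r) = if ∀ s ∈ c, s = false then dn c + 1 else dn c := by
  induction c with
  | nil => simpa [dn] using dn_replicate_append 0 h
  | cons s c ih => cases s <;> simp [dn, ih]; split_ifs <;> rfl

theorem forall_append_replicate_iff {l : List Bool} {a : ℕ} (h : l.getLast? ≠ some true) :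
    (∀ s ∈ l ++ List.replicate a true, s = true) ↔ l = [] := by
  constructor
  · intro hl
    rcases List.eq_nil_or_concat l with rfl | ⟨l, t, rfl⟩
    · rfl
    · exact absurd (hl t (by simp)) (by simpa using h)
  · rintro rfl s hs
    exact List.eq_of_mem_replicate (by simpa using hs)

theorem forall_replicate_append_iff {l : List Bool} {b : ℕ} (h : l.head? ≠ some false) :
    (∀ s ∈ List.replicate b false ++ l, s = false) ↔ l = [] := by
  constructor
  · intro hl
    rcases l with _ | ⟨t, l⟩
    · rfl
    · exact absurd (hl t (by simp)) (by simpa using h)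
  · rintro rfl s hs
    exact List.eq_of_mem_replicate (by simpa using hs)

theorem containsRunPair_iff {α β : RunAdj} {p : List Bool} :
    ContainsRunPair α β p ↔ Peak (RunRel α β) p := by
  constructor
  · rintro ⟨l₁, a, b, l₂, rfl, ha, hb, h₁, h₂, hα, hβ⟩
    obtain ⟨a, rfl⟩ := Nat.exists_eq_add_of_le' ha
    obtain ⟨b, rfl⟩ := Nat.exists_eq_add_of_le' hb
    refine ⟨l₁ ++ List.replicate (a + 1) true, List.replicate (b + 1) false ++ l₂, by simp,
      by simp [List.replicate_succ'], by simp [List.replicate_succ], ?_⟩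
    rw [RunRel, up_append_replicate _ h₁, dn_replicate_append _ h₂]
    refine ⟨?_, ?_⟩
    · convert hα using 1
      · simp
      · exact forall_append_replicate_iff h₁
    · convert hβ using 1
      · simp
      · exact forall_replicate_append_iff h₂
  · rintro ⟨x, y, rfl, hx, hy, hα, hβ⟩
    obtain ⟨l₁, h₁, h₁'⟩ := exists_append_replicate_up x
    obtain ⟨l₂, h₂, h₂'⟩ := exists_replicate_dn_append y
    have hht : ht x = ht l₁ + up x := by conv_lhs => rw [h₁]; simp
    refine ⟨l₁, up x, dn y, l₂, ?_, ?_, ?_, h₁', h₂', ?_, ?_⟩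
    · rw [← h₁, List.append_assoc, ← h₂]
    · by_contra h
      rw [show up x = 0 by omega] at h₁
      simp only [List.replicate_zero, List.append_nil] at h₁
      exact h₁' (h₁ ▸ hx)
    · by_contra h
      rw [show dn y = 0 by omega] at h₂
      simp only [List.replicate_zero, List.nil_append] at h₂
      exact h₂' (h₂ ▸ hy)
    · convert hα using 1
      · rw [hht]; simp
      · rw [← forall_append_replicate_iff h₁', ← h₁]
    · convert hβ using 1
      · rw [hht]
      · rw [← forall_replicate_append_iff h₂', ← h₂]

theorem Peak.congr {R R' : List Bool → List Bool → Prop} {p : List Bool}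
    (h : ∀ x y, p = x ++ y → (R x y ↔ R' x y)) : Peak R p ↔ Peak R' p := by
  constructor <;> rintro ⟨x, y, e, hx, hy, hR⟩
  · exact ⟨x, y, e, hx, hy, (h x y e).1 hR⟩
  · exact ⟨x, y, e, hx, hy, (h x y e).2 hR⟩

@[simp] theorem not_peak_nil (R : List Bool → List Bool → Prop) : ¬ Peak R [] := by
  rintro ⟨x, y, e, hx, hy, -⟩
  simp_all

theorem path_head (t : BinaryTree Unit) : (path t).head? ≠ some false := by
  cases t <;> simp [path]

@[simp] theorem path_eq_nil {t : BinaryTree Unit} : path t = [] ↔ t = nil := by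
  cases t <;> simp [path]

theorem path_getLast (t : BinaryTree Unit) : (path t).getLast? ≠ some true := by
  induction t with
  | nil => simp [path]
  | node _ q r _ ih =>
    rcases List.eq_nil_or_concat (path r) with h | ⟨l, t, h⟩
    · simp [path, h, List.getLast?_cons]
    · rw [h] at ih
      simpa [path, h, List.getLast?_cons, List.getLast?_append] using ih

@[simp] theorem ht_path (t : BinaryTree Unit) : ht (path t) = 0 := by
  induction t with
  | nil => simp [path]
  | node _ q r hq hr => simp [path, hq, hr]

theorem length_path (t : BinaryTree Unit) : (path t).length = 2 * t.numNodes := by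
  induction t with
  | nil => simp [path]
  | node _ q r hq hr => simp [path, hq, hr, numNodes]; ring

theorem ht_nonneg_of_prefix {t : BinaryTree Unit} {x y : List Bool} (h : path t = x ++ y) :
    0 ≤ ht x := by
  induction t generalizing x y with
  | nil => simp_all [path]
  | node _ q r hq hr =>
    rcases x with _ | ⟨s, x⟩
    · simp
    · simp only [path, List.cons_append, List.cons.injEq] at h
      obtain ⟨rfl, h⟩ := h
      rcases List.append_eq_append_iff.1 h with ⟨c, rfl, hc⟩ | ⟨c, hc, -⟩
      · rcases c with _ | ⟨s, c⟩
        · simp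
        · simp only [List.cons_append, List.cons.injEq] at hc
          obtain ⟨rfl, hc⟩ := hc
          simpa using hr hc
      · have := hq hc
        rw [ht_cons_true]; omega

theorem isDyck_path (t : BinaryTree Unit) : IsDyck (path t) := by
  constructor
  · have h := ht_path t
    rw [ht_eq_sub] at h
    omega
  · intro i
    have h := ht_nonneg_of_prefix (List.take_append_drop i (path t)).symm
    rw [ht_eq_sub] at h
    omega

theorem path_append_false_inj {t t' : BinaryTree Unit} {s s' : List Bool}
    (h : path t ++ false :: s = path t' ++ false :: s') : t = t' ∧ s = s' := by
  induction t generalizing t' s s' with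
  | nil => cases t' <;> simp_all [path]
  | node _ q r hq hr =>
    cases t' with
    | nil => simp [path] at h
    | node _ q' r' =>
      simp only [path, List.cons_append, List.append_assoc, List.cons.injEq, true_and] at h
      obtain ⟨rfl, hs⟩ := hq h
      obtain ⟨rfl, rfl⟩ := hr hs
      exact ⟨rfl, rfl⟩

theorem path_injective : Function.Injective path := fun t t' h =>
  (path_append_false_inj (s := []) (s' := []) (by rw [h])).1

theorem exists_path_append_false (n : ℕ) (p : List Bool) (hn : p.length ≤ n) (hp : ht p < 0) :
    ∃ t s, p = path t ++ false :: s := by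
  induction n generalizing p with
  | zero => simp_all
  | succ n ih =>
    rcases p with _ | ⟨_ | _, p⟩
    · simp at hp
    · exact ⟨nil, p, rfl⟩
    · simp only [List.length_cons, ht_cons_true] at hn hp
      obtain ⟨q, s, rfl⟩ := ih p (by omega) (by omega)
      simp only [List.length_append, List.length_cons, ht_append, ht_path, ht_cons_false] at hn hp
      obtain ⟨r, s, rfl⟩ := ih s (by omega) (by omega)
      exact ⟨node () q r, s, by simp [path]⟩

theorem exists_path_eq {p : List Bool} (hp : IsDyck p) : ∃ t, path t = p := by
  have h0 : ht p = 0 := by rw [ht_eq_sub, hp.1]; simp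
  obtain ⟨t, s, h⟩ := exists_path_append_false _ (p ++ [false]) le_rfl (by simp [h0])
  rcases List.eq_nil_or_concat s with rfl | ⟨s, c, rfl⟩
  · exact ⟨t, (List.append_cancel_right h).symm⟩
  · exfalso
    have h' : p ++ [false] = (path t ++ false :: s) ++ [c] := by simpa using h
    obtain ⟨rfl, -⟩ := List.append_inj' h' rfl
    have := hp.2 ((path t).length + 1)
    rw [show path t ++ false :: s = (path t ++ [false]) ++ s by simp,
      List.take_left' (by simp)] at this
    have h2 : ht (path t ++ [false]) = -1 := by simp
    rw [ht_eq_sub] at h2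
    omega

theorem peak_node {R : List Bool → List Bool → Prop} {u : Unit} {q r : BinaryTree Unit} :
    Peak R (path (node u q r)) ↔
      (q = nil ∧ R [true] (false :: path r)) ∨
      Peak (fun x y => R (true :: x) (y ++ false :: path r)) (path q) ∨
      Peak (fun x y => R (true :: (path q ++ false :: x)) y) (path r) := by
  constructor
  · rintro ⟨x, y, e, hx, hy, hR⟩
    have edge : ∀ x y, x = true :: path q → y = false :: path r → x.getLast? = some true →
        R x y → q = nil ∧ R [true] (false :: path r) := by
      rintro x y rfl rfl hx hR
      have hq : q = nil := by
        by_contra hq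
        rcases List.eq_nil_or_concat (path q) with h | ⟨l, t, h⟩
        · exact hq (path_eq_nil.1 h)
        · have := path_getLast q
          rw [h] at hx this
          exact this (by simpa [List.getLast?_cons] using hx)
      subst hq
      exact ⟨rfl, hR⟩
    rcases x with _ | ⟨s, x⟩
    · simp at hx
    simp only [path, List.cons_append, List.cons.injEq] at e
    obtain ⟨rfl, e⟩ := e
    rcases List.append_eq_append_iff.1 e with ⟨c, rfl, hc⟩ | ⟨c, hc, rfl⟩
    · rcases c with _ | ⟨s, c⟩
      · exact Or.inl (edge _ _ (by simp) hc.symm hx hR)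
      · simp only [List.cons_append, List.cons.injEq] at hc
        obtain ⟨rfl, hc⟩ := hc
        refine Or.inr (Or.inr ⟨c, y, hc, ?_, hy, hR⟩)
        rcases List.eq_nil_or_concat c with rfl | ⟨l, t, rfl⟩ <;>
          simp_all [List.getLast?_cons, List.getLast?_append]
    · rcases c with _ | ⟨s, c⟩
      · exact Or.inl (edge _ _ (by simp [hc]) (by simp) hx hR)
      · refine Or.inr (Or.inl ⟨x, s :: c, hc, ?_, by simpa using hy, hR⟩)
        rcases List.eq_nil_or_concat x with rfl | ⟨l, t, rfl⟩
        · have := path_head q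
          simp_all
        · simpa [List.getLast?_cons] using hx
  · rintro (⟨rfl, hR⟩ | ⟨x, y, e, hx, hy, hR⟩ | ⟨x, y, e, hx, hy, hR⟩)
    · exact ⟨_, _, by simp [path], by simp, by simp, hR⟩
    · exact ⟨_, _, by simp [path, e], by simp [List.getLast?_cons, hx], by simp [hy], hR⟩
    · refine ⟨_, _, by simp [path, e], ?_, hy, hR⟩
      simp [List.getLast?_cons, List.getLast?_append, hx]

theorem peak_node_iff {R R₁ R₂ : List Bool → List Bool → Prop} {u : Unit}
    {q r : BinaryTree Unit}
    (h₁ : ∀ x y, path q = x ++ y → (R (true :: x) (y ++ false :: path r) ↔ R₁ x y))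
    (h₂ : ∀ x y, path r = x ++ y → (R (true :: (path q ++ false :: x)) y ↔ R₂ x y)) :
    Peak R (path (node u q r)) ↔
      (q = nil ∧ R [true] (false :: path r)) ∨ Peak R₁ (path q) ∨ Peak R₂ (path r) := by
  rw [peak_node, Peak.congr h₁, Peak.congr h₂]

theorem dn_cons_path (r : BinaryTree Unit) : dn (false :: path r) = 1 := by
  simpa using dn_replicate_append 1 (path_head r)

section Adjectives

variable {x y q : List Bool} {r : BinaryTree Unit} {a a' b b' : Prop}

theorem oddAdj_cons :
    oddAdj (up (true :: x)) a b ↔ strangeAdj (up x) a' (∀ s ∈ x, s = true) := by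
  by_cases h : ∀ s ∈ x, s = true
  · rw [up, if_pos ⟨rfl, h⟩]
    simp only [oddAdj, strangeAdj]
    grind
  · rw [up, if_neg (by tauto)]
    simp only [oddAdj, strangeAdj, h]
    tauto

theorem strangeAdj_cons :
    strangeAdj (up (true :: x)) a (∀ s ∈ true :: x, s = true) ↔ oddAdj (up x) a' b' := by
  rw [List.forall_mem_cons]
  by_cases h : ∀ s ∈ x, s = true
  · rw [up, if_pos ⟨rfl, h⟩]
    simp only [oddAdj, strangeAdj]
    grind
  · rw [up, if_neg (by tauto)]
    simp only [oddAdj, strangeAdj, h]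
    tauto

theorem up_cons_append_false : up (true :: (q ++ false :: x)) = up x := by
  rw [← List.cons_append, up_append_false]

theorem oddAdj_cons_append_false :
    oddAdj (up (true :: (q ++ false :: x))) a b ↔ oddAdj (up x) a' b' := by
  rw [up_cons_append_false]; rfl

theorem strangeAdj_cons_append_false :
    strangeAdj (up (true :: (q ++ false :: x))) a
      (∀ s ∈ true :: (q ++ false :: x), s = true) ↔ oddAdj (up x) a' b' := by
  rw [up_cons_append_false]
  simp [oddAdj, strangeAdj]

theorem oddAdj_append :
    oddAdj (dn (y ++ false :: path r)) a b ↔ strangeAdj (dn y) a' (∀ s ∈ y, s = false) := by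
  rw [dn_append_false (path_head r)]
  split_ifs with h
  · simp only [oddAdj, strangeAdj]
    grind
  · simp only [oddAdj, strangeAdj, h]
    tauto

theorem strangeAdj_append_path_nil :
    strangeAdj (dn (y ++ false :: path nil)) a (∀ s ∈ y ++ false :: path nil, s = false) ↔
      oddAdj (dn y) a' b' := by
  rw [dn_append_false (path_head nil), List.forall_mem_append]
  split_ifs with h
  · simp only [oddAdj, strangeAdj, path]
    simp
    grind
  · simp only [oddAdj, strangeAdj, h]
    tauto

theorem not_forall_path_eq_false (hr : r ≠ nil) : ¬ ∀ s ∈ path r, s = false := by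
  cases r <;> simp_all [path]

theorem strangeAdj_append_path (hr : r ≠ nil) :
    strangeAdj (dn (y ++ false :: path r)) a (∀ s ∈ y ++ false :: path r, s = false) ↔
      strangeAdj (dn y) a' (∀ s ∈ y, s = false) := by
  have h := not_forall_path_eq_false hr
  have h' : ¬ ∀ s ∈ y ++ false :: path r, s = false := fun H =>
    h fun s hs => H s (by simp [hs])
  have := oddAdj_append (y := y) (r := r) (a := a) (b := a) (a' := a')
  rw [← this]
  simp only [h', strangeAdj, oddAdj]
  tauto

end Adjectives

theorem peak_odd_odd {q r : BinaryTree Unit} :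
    Peak (RunRel oddAdj oddAdj) (path (node () q r)) ↔
      q = nil ∨ Peak (RunRel strangeAdj strangeAdj) (path q) ∨
        Peak (RunRel oddAdj oddAdj) (path r) := by
  have edge : RunRel oddAdj oddAdj [true] (false :: path r) := by
    simp [RunRel, oddAdj, dn_cons_path, up]
  rw [peak_node_iff (R₁ := RunRel strangeAdj strangeAdj) (R₂ := RunRel oddAdj oddAdj)
    (fun x y _ => and_congr oddAdj_cons oddAdj_append)
    (fun x y _ => and_congr_left' oddAdj_cons_append_false)]
  simp only [edge, and_true]

theorem peak_strange_odd {q r : BinaryTree Unit} :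
    Peak (RunRel strangeAdj oddAdj) (path (node () q r)) ↔
      Peak (RunRel oddAdj strangeAdj) (path q) ∨ Peak (RunRel oddAdj oddAdj) (path r) := by
  have edge : ¬ RunRel strangeAdj oddAdj [true] (false :: path r) := by
    simp [RunRel, strangeAdj, up]
  rw [peak_node_iff (R₁ := RunRel oddAdj strangeAdj) (R₂ := RunRel oddAdj oddAdj)
    (fun x y _ => and_congr strangeAdj_cons oddAdj_append)
    (fun x y _ => and_congr_left' strangeAdj_cons_append_false)]
  simp only [edge, and_false, false_or]

theorem peak_odd_strange_nil {q : BinaryTree Unit} :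
    Peak (RunRel oddAdj strangeAdj) (path (node () q nil)) ↔
      Peak (RunRel strangeAdj oddAdj) (path q) := by
  have edge : ¬ RunRel oddAdj strangeAdj [true] [false] := by
    simp [RunRel, strangeAdj, dn]
  rw [peak_node_iff (R₁ := RunRel strangeAdj oddAdj) (R₂ := RunRel oddAdj strangeAdj)
    (fun x y _ => and_congr oddAdj_cons strangeAdj_append_path_nil)
    (fun x y _ => and_congr_left' oddAdj_cons_append_false)]
  simp only [edge, and_false, false_or, path, not_peak_nil, or_false]

theorem peak_odd_strange {q r : BinaryTree Unit} (hr : r ≠ nil) :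
    Peak (RunRel oddAdj strangeAdj) (path (node () q r)) ↔
      q = nil ∨ Peak (RunRel strangeAdj strangeAdj) (path q) ∨
        Peak (RunRel oddAdj strangeAdj) (path r) := by
  have edge : RunRel oddAdj strangeAdj [true] (false :: path r) := by
    have := not_forall_path_eq_false hr
    simp_all [RunRel, oddAdj, strangeAdj, dn_cons_path, up]
  rw [peak_node_iff (R₁ := RunRel strangeAdj strangeAdj) (R₂ := RunRel oddAdj strangeAdj)
    (fun x y _ => and_congr oddAdj_cons (strangeAdj_append_path hr))
    (fun x y _ => and_congr_left' oddAdj_cons_append_false)]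
  simp only [edge, and_true]

theorem peak_strange_strange_nil {q : BinaryTree Unit} :
    Peak (RunRel strangeAdj strangeAdj) (path (node () q nil)) ↔
      Peak (RunRel oddAdj oddAdj) (path q) := by
  have edge : ¬ RunRel strangeAdj strangeAdj [true] [false] := by
    simp [RunRel, strangeAdj, dn]
  rw [peak_node_iff (R₁ := RunRel oddAdj oddAdj) (R₂ := RunRel oddAdj strangeAdj)
    (fun x y _ => and_congr strangeAdj_cons strangeAdj_append_path_nil)
    (fun x y _ => and_congr_left' strangeAdj_cons_append_false)]
  simp only [edge, and_false, false_or, path, not_peak_nil, or_false]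

theorem peak_strange_strange {q r : BinaryTree Unit} (hr : r ≠ nil) :
    Peak (RunRel strangeAdj strangeAdj) (path (node () q r)) ↔
      Peak (RunRel oddAdj strangeAdj) (path q) ∨ Peak (RunRel oddAdj strangeAdj) (path r) := by
  have edge : ¬ RunRel strangeAdj strangeAdj [true] (false :: path r) := by
    simp [RunRel, strangeAdj, up]
  rw [peak_node_iff (R₁ := RunRel oddAdj strangeAdj) (R₂ := RunRel oddAdj strangeAdj)
    (fun x y _ => and_congr strangeAdj_cons (strangeAdj_append_path hr))
    (fun x y _ => and_congr_left' strangeAdj_cons_append_false)]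
  simp only [edge, and_false, false_or]

theorem up_le_ht {t : BinaryTree Unit} {x y : List Bool} (h : path t = x ++ y) :
    (up x : ℤ) ≤ ht x := by
  obtain ⟨l, hl, -⟩ := exists_append_replicate_up x
  have h0 : 0 ≤ ht l := ht_nonneg_of_prefix (t := t) (y := List.replicate (up x) true ++ y)
    (by rw [← List.append_assoc, ← hl, h])
  have := congrArg ht hl
  simp only [ht_append, ht_replicate_true] at this
  omega

theorem dn_le_ht {t : BinaryTree Unit} {x y : List Bool} (h : path t = x ++ y) :
    (dn y : ℤ) ≤ ht x := by
  obtain ⟨l, hl, -⟩ := exists_replicate_dn_append y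
  have h0 : 0 ≤ ht (x ++ List.replicate (dn y) false) := ht_nonneg_of_prefix (t := t) (y := l)
    (by rw [List.append_assoc, ← hl, h])
  simp only [ht_append, ht_replicate_false] at h0
  omega

theorem peak_weird_weird {q r : BinaryTree Unit} :
    Peak (RunRel weirdAdj weirdAdj) (path (node () q r)) ↔
      Peak (RunRel oddAdj oddAdj) (path q) ∨ Peak (RunRel weirdAdj weirdAdj) (path r) := by
  have h₁ : ∀ x y, path q = x ++ y → (RunRel weirdAdj weirdAdj (true :: x)
      (y ++ false :: path r) ↔ RunRel oddAdj oddAdj x y) := by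
    intro x y h
    refine and_congr ?_ ?_
    · have hle := up_le_ht h
      rw [ht_cons_true]
      by_cases hx : ∀ s ∈ x, s = true
      · have := ht_eq_up hx
        rw [up, if_pos ⟨rfl, hx⟩, this]
        simp only [weirdAdj, oddAdj]
        push_cast
        grind
      · rw [up, if_neg (by tauto)]
        have : ¬ (1 + ht x = up x) := by omega
        simp only [weirdAdj, oddAdj, this]
        tauto
    · have hle := dn_le_ht h
      have h0 := ht_path q
      rw [h, ht_append] at h0
      rw [ht_cons_true, dn_append_false (path_head r)]
      split_ifs with hy
      · have := ht_eq_neg_dn hy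
        have : 1 + ht x = (dn y + 1 : ℕ) := by push_cast; omega
        simp only [weirdAdj, oddAdj, this]
        grind
      · have : ¬ (1 + ht x = dn y) := by omega
        simp only [weirdAdj, oddAdj, this]
        tauto
  have h₂ : ∀ x y, path r = x ++ y →
      (RunRel weirdAdj weirdAdj (true :: (path q ++ false :: x)) y ↔
        RunRel weirdAdj weirdAdj x y) := by
    intro x y _
    have : ht (true :: (path q ++ false :: x)) = ht x := by simp
    rw [RunRel, RunRel, up_cons_append_false, this]
    rfl
  rw [peak_node_iff h₁ h₂]
  simp [RunRel, weirdAdj, up]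

/-- The generating function of binary trees, counted by internal nodes, with weights `w`. -/
noncomputable def treeGF (w : BinaryTree Unit → ℚ) : PowerSeries ℚ :=
  PowerSeries.mk fun n => ∑ t ∈ treesOfNumNodesEq n, w t

open Classical in
/-- The indicator of the trees whose path avoids an `α` ascending run followed by a `β`
descending run. -/
noncomputable def avoid (α β : RunAdj) (t : BinaryTree Unit) : ℚ :=
  if Peak (RunRel α β) (path t) then 0 else 1

theorem gfAvoid_eq (α β : RunAdj) : gfAvoid α β = treeGF (avoid α β) := by
  classical
  ext n
  simp only [gfAvoid, treeGF, PowerSeries.coeff_mk]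
  rw [Nat.subtype_card
    (((treesOfNumNodesEq n).filter fun t => ¬ Peak (RunRel α β) (path t)).map
      ⟨path, path_injective⟩)]
  · rw [Finset.card_map, Finset.natCast_card_filter]
    simp only [avoid, ite_not]
  · intro p
    simp only [Finset.mem_map, Finset.mem_filter, mem_treesOfNumNodesEq,
      Function.Embedding.coeFn_mk, containsRunPair_iff]
    constructor
    · rintro ⟨t, ⟨rfl, h⟩, rfl⟩
      exact ⟨isDyck_path t, length_path t, h⟩
    · rintro ⟨hp, hn, h⟩
      obtain ⟨t, rfl⟩ := exists_path_eq hp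
      rw [length_path] at hn
      exact ⟨t, ⟨by omega, h⟩, rfl⟩

theorem sum_treesOfNumNodesEq_succ (n : ℕ) (w : BinaryTree Unit → ℚ) :
    ∑ t ∈ treesOfNumNodesEq (n + 1), w t = ∑ ij ∈ Finset.HasAntidiagonal.antidiagonal n,
      ∑ q ∈ treesOfNumNodesEq ij.1, ∑ r ∈ treesOfNumNodesEq ij.2, w (node () q r) := by
  rw [treesOfNumNodesEq_succ, Finset.sum_biUnion]
  · refine Finset.sum_congr rfl fun ij _ => ?_
    rw [pairwiseNode, Finset.sum_map, Finset.sum_product]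
    rfl
  · simp_rw [Set.PairwiseDisjoint, Set.Pairwise, Finset.disjoint_left]
    rintro ⟨i, j⟩ _ ⟨i', j'⟩ _ hne t h h'
    apply hne
    simp only [pairwiseNode, Finset.mem_map, Finset.mem_product, mem_treesOfNumNodesEq] at h h'
    obtain ⟨⟨a, b⟩, ⟨rfl, rfl⟩, rfl⟩ := h
    obtain ⟨⟨a', b'⟩, ⟨rfl, rfl⟩, h'⟩ := h'
    simp_all

open PowerSeries

theorem treeGF_node {w u v u' v' : BinaryTree Unit → ℚ} (h0 : w nil = 1)
    (h : ∀ q r, w (node () q r) = u q * v r + u' q * v' r) :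
    treeGF w - 1 = X * (treeGF u * treeGF v + treeGF u' * treeGF v') := by
  ext n
  rcases n with _ | n
  · simp [treeGF, h0]
  · rw [coeff_succ_X_mul, map_sub, map_add, coeff_mul, coeff_mul, ← Finset.sum_add_distrib]
    simp only [treeGF, coeff_mk, sum_treesOfNumNodesEq_succ, h, Finset.sum_add_distrib,
      Finset.sum_mul_sum]
    simp [coeff_one]

theorem treeGF_ne_nil {u : BinaryTree Unit → ℚ} (h0 : u nil = 1) :
    treeGF (fun t => if t = nil then 0 else u t) = treeGF u - 1 := by
  ext n
  rcases n with _ | n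
  · simp [treeGF, h0]
  · simp [treeGF, coeff_one, sum_treesOfNumNodesEq_succ]

theorem treeGF_nil : treeGF (fun t => if t = nil then 1 else 0) = 1 := by
  ext n
  rcases n with _ | n
  · simp [treeGF]
  · simp [treeGF, coeff_one]

@[simp] theorem treeGF_zero : treeGF (fun _ => 0) = 0 := by
  ext n
  simp [treeGF]

@[simp] theorem avoid_nil (α β : RunAdj) : avoid α β nil = 1 := by
  simp [avoid, path]

end DyckAvoid

open PowerSeries in
/-- The system of equations satisfied by the generating functions (by semilength) of
Dyck paths that are (odd, odd)-, (weird, weird)-, (strange, strange)-, (odd, strange)- and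
(strange, odd)-avoiding. -/
theorem dyck_avoidance_gf_system :
    gfAvoid weirdAdj weirdAdj - 1 = X * gfAvoid oddAdj oddAdj * gfAvoid weirdAdj weirdAdj ∧
    gfAvoid oddAdj oddAdj - 1 =
      X * (gfAvoid strangeAdj strangeAdj - 1) * gfAvoid oddAdj oddAdj ∧
    gfAvoid strangeAdj strangeAdj - 1 =
      X * gfAvoid oddAdj oddAdj +
        X * gfAvoid oddAdj strangeAdj * (gfAvoid oddAdj strangeAdj - 1) ∧
    gfAvoid oddAdj strangeAdj - 1 =
      X * gfAvoid strangeAdj oddAdj +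
        X * (gfAvoid strangeAdj strangeAdj - 1) * (gfAvoid oddAdj strangeAdj - 1) ∧
    gfAvoid oddAdj strangeAdj = gfAvoid strangeAdj oddAdj := by
  simp only [DyckAvoid.gfAvoid_eq]
  have hW := DyckAvoid.treeGF_node (w := DyckAvoid.avoid weirdAdj weirdAdj)
    (u := DyckAvoid.avoid oddAdj oddAdj) (v := DyckAvoid.avoid weirdAdj weirdAdj)
    (u' := fun _ => 0) (v' := fun _ => 0) (by simp) (fun q r => by
      have := DyckAvoid.peak_weird_weird (q := q) (r := r)
      simp only [DyckAvoid.avoid]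
      split_ifs <;> simp_all)
  have hF := DyckAvoid.treeGF_node (w := DyckAvoid.avoid oddAdj oddAdj)
    (u := fun t => if t = .nil then 0 else DyckAvoid.avoid strangeAdj strangeAdj t)
    (v := DyckAvoid.avoid oddAdj oddAdj)
    (u' := fun _ => 0) (v' := fun _ => 0) (by simp) (fun q r => by
      have := DyckAvoid.peak_odd_odd (q := q) (r := r)
      simp only [DyckAvoid.avoid]
      split_ifs <;> simp_all)
  have hH := DyckAvoid.treeGF_node (w := DyckAvoid.avoid strangeAdj oddAdj)
    (u := DyckAvoid.avoid oddAdj strangeAdj) (v := DyckAvoid.avoid oddAdj oddAdj)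
    (u' := fun _ => 0) (v' := fun _ => 0) (by simp) (fun q r => by
      have := DyckAvoid.peak_strange_odd (q := q) (r := r)
      simp only [DyckAvoid.avoid]
      split_ifs <;> simp_all)
  have hS := DyckAvoid.treeGF_node (w := DyckAvoid.avoid strangeAdj strangeAdj)
    (u := DyckAvoid.avoid oddAdj oddAdj) (v := fun t => if t = .nil then 1 else 0)
    (u' := DyckAvoid.avoid oddAdj strangeAdj)
    (v' := fun t => if t = .nil then 0 else DyckAvoid.avoid oddAdj strangeAdj t)
    (by simp) (fun q r => by
      by_cases hr : r = .nil
      · subst hr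
        have := DyckAvoid.peak_strange_strange_nil (q := q)
        simp only [DyckAvoid.avoid]
        split_ifs <;> simp_all
      · have := DyckAvoid.peak_strange_strange (q := q) hr
        simp only [DyckAvoid.avoid]
        split_ifs <;> simp_all)
  have hG := DyckAvoid.treeGF_node (w := DyckAvoid.avoid oddAdj strangeAdj)
    (u := DyckAvoid.avoid strangeAdj oddAdj) (v := fun t => if t = .nil then 1 else 0)
    (u' := fun t => if t = .nil then 0 else DyckAvoid.avoid strangeAdj strangeAdj t)
    (v' := fun t => if t = .nil then 0 else DyckAvoid.avoid oddAdj strangeAdj t)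
    (by simp) (fun q r => by
      by_cases hr : r = .nil
      · subst hr
        have := DyckAvoid.peak_odd_strange_nil (q := q)
        simp only [DyckAvoid.avoid]
        split_ifs <;> simp_all
      · have := DyckAvoid.peak_odd_strange (q := q) hr
        simp only [DyckAvoid.avoid]
        split_ifs <;> simp_all)
  simp only [DyckAvoid.treeGF_nil, DyckAvoid.treeGF_zero, DyckAvoid.treeGF_ne_nil,
    DyckAvoid.avoid_nil] at hW hF hH hS hG
  generalize DyckAvoid.treeGF (DyckAvoid.avoid weirdAdj weirdAdj) = W at *
  generalize DyckAvoid.treeGF (DyckAvoid.avoid oddAdj oddAdj) = F at *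
  generalize DyckAvoid.treeGF (DyckAvoid.avoid strangeAdj strangeAdj) = S at *
  generalize DyckAvoid.treeGF (DyckAvoid.avoid oddAdj strangeAdj) = G at *
  generalize DyckAvoid.treeGF (DyckAvoid.avoid strangeAdj oddAdj) = H at *
  refine ⟨by linear_combination hW, by linear_combination hF, by linear_combination hS,
    by linear_combination hG, ?_⟩
  have hmul : (1 + X * F) * (G - H) = 0 := by
    linear_combination F * hG - hH - (G - 1) * hF
  have hne : (1 + X * F : PowerSeries ℚ) ≠ 0 := fun h => by
    simpa using congrArg (coeff 0) h
  exact sub_eq_zero.1 ((mul_eq_zero.1 hmul).resolve_left hne)
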